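/- Let (ρ̄, Ē) be a C¹ solution of the reduced system on an interval I with ρ̄(r) > 0 and c̄²(r) ≠ Ū1²(r) for all r ∈ I. Then the squared angular Mach number satisfies the identity (M̄2²)'(r) = −(M̄2²(r)/(r(1 − M̄1²(r)))) · ((γ−3) M̄1²(r) + (γ−1) M̄2²(r) + (γ−1) r Ē(r)/c̄²(r) + 2) for all r ∈ I. -/

import Mathlib

open Real Set

/-- Radial velocity `Ū1(r) = J1/(r ρ̄(r))` of the background flow. -/
noncomputable def Ubar1 (J1 : ℝ) (ρ : ℝ → ℝ) (r : ℝ) : ℝ := J1 / (r * ρ r)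

/-- Angular velocity `Ū2(r) = J2/r` of the background flow. -/
noncomputable def Ubar2 (J2 r : ℝ) : ℝ := J2 / r

/-- Squared sound speed `c̄²(r) = γ e^{S0} ρ̄(r)^{γ−1}`. -/
noncomputable def csq (γ S0 : ℝ) (ρ : ℝ → ℝ) (r : ℝ) : ℝ :=
  γ * Real.exp S0 * ρ r ^ (γ - 1)

/-- Squared radial Mach number `M̄1²(r) = Ū1²(r)/c̄²(r)`. -/
noncomputable def M1sq (γ S0 J1 : ℝ) (ρ : ℝ → ℝ) (r : ℝ) : ℝ :=
  (Ubar1 J1 ρ r) ^ 2 / csq γ S0 ρ r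

/-- Squared angular Mach number `M̄2²(r) = Ū2²(r)/c̄²(r)`. -/
noncomputable def M2sq (γ S0 J2 : ℝ) (ρ : ℝ → ℝ) (r : ℝ) : ℝ :=
  (Ubar2 J2 r) ^ 2 / csq γ S0 ρ r

/-- The reduced ODE system for `(ρ̄, Ē)` on the interval `[r0, r1]`:
`ρ̄'(r) = ρ̄(r)(Ū1² + Ū2² + r Ē)/(r (c̄² − Ū1²))` and `(r Ē)'(r) = r (ρ̄(r) − b0)`,
for `C¹` functions `ρ, E`. -/
def ReducedSystem (γ S0 b0 J1 J2 r0 r1 : ℝ) (ρ E : ℝ → ℝ) : Prop :=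
  ContDiffOn ℝ 1 ρ (Icc r0 r1) ∧ ContDiffOn ℝ 1 E (Icc r0 r1) ∧
  (∀ r ∈ Icc r0 r1,
    derivWithin ρ (Icc r0 r1) r =
      ρ r * ((Ubar1 J1 ρ r) ^ 2 + (Ubar2 J2 r) ^ 2 + r * E r)
        / (r * (csq γ S0 ρ r - (Ubar1 J1 ρ r) ^ 2))) ∧
  (∀ r ∈ Icc r0 r1, derivWithin (fun s => s * E s) (Icc r0 r1) r = r * (ρ r - b0))

/-- The squared sound speed of a positive differentiable density has logarithmic derivative
`(γ - 1) ρ' / ρ`. -/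
theorem hasDerivWithinAt_csq {γ S0 ρ' r : ℝ} {ρ : ℝ → ℝ} {s : Set ℝ}
    (hρ : HasDerivWithinAt ρ ρ' s r) (hpos : 0 < ρ r) :
    HasDerivWithinAt (csq γ S0 ρ) (csq γ S0 ρ r * ((γ - 1) * ρ' / ρ r)) s r := by
  refine ((hρ.rpow_const (p := γ - 1) (Or.inl hpos.ne')).const_mul
    (γ * Real.exp S0)).congr_deriv ?_
  rw [Real.rpow_sub_one hpos.ne', csq]
  ring

/-- The squared angular Mach number has logarithmic derivative `-(2 / r + (γ - 1) ρ' / ρ)`. -/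
theorem hasDerivWithinAt_M2sq {γ S0 J2 ρ' r : ℝ} {ρ : ℝ → ℝ} {s : Set ℝ}
    (hρ : HasDerivWithinAt ρ ρ' s r) (hpos : 0 < ρ r) (hr : r ≠ 0) (hc : csq γ S0 ρ r ≠ 0) :
    HasDerivWithinAt (M2sq γ S0 J2 ρ)
      (-(M2sq γ S0 J2 ρ r * (2 / r + (γ - 1) * ρ' / ρ r))) s r := by
  have hU : HasDerivWithinAt (Ubar2 J2) (-J2 / r ^ 2) s r :=
    ((hasDerivWithinAt_const r s J2).fun_div (hasDerivWithinAt_id r s) hr).congr_deriv (by simp)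
  refine ((hU.fun_pow 2).fun_div (hasDerivWithinAt_csq hρ hpos) hc).congr_deriv ?_
  have hρr := hpos.ne'
  simp only [M2sq, Ubar2, Nat.add_one_sub_one, Nat.cast_ofNat, pow_one]
  field_simp
  ring

/-- For a `C¹` solution of the reduced system with `ρ̄ > 0` and `c̄² ≠ Ū1²`, the squared
angular Mach number satisfies
`(M̄2²)' = −(M̄2²/(r(1 − M̄1²))) ((γ−3) M̄1² + (γ−1) M̄2² + (γ−1) r Ē/c̄² + 2)`. -/
theorem M2sq_derivative_identity
    (γ r0 r1 b0 J1 J2 S0 : ℝ)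
    (hγ : 1 < γ) (hr0 : 0 < r0) (hr01 : r0 < r1) (hb0 : 0 < b0)
    (hJ1 : 0 < J1) (hJ2 : J2 ≠ 0) (hS0 : 0 < S0)
    (ρ E : ℝ → ℝ)
    (hsol : ReducedSystem γ S0 b0 J1 J2 r0 r1 ρ E)
    (hρpos : ∀ r ∈ Icc r0 r1, 0 < ρ r)
    (hnonsonic : ∀ r ∈ Icc r0 r1, csq γ S0 ρ r ≠ (Ubar1 J1 ρ r) ^ 2) :
    ∀ r ∈ Icc r0 r1,
      derivWithin (fun s => M2sq γ S0 J2 ρ s) (Icc r0 r1) r =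
        -(M2sq γ S0 J2 ρ r / (r * (1 - M1sq γ S0 J1 ρ r))) *
          ((γ - 3) * M1sq γ S0 J1 ρ r + (γ - 1) * M2sq γ S0 J2 ρ r
            + (γ - 1) * (r * E r) / csq γ S0 ρ r + 2) := by
  intro r hr
  obtain ⟨hρ, -, hode, -⟩ := hsol
  have hrpos : r ≠ 0 := (hr0.trans_le hr.1).ne'
  have hpos := hρpos r hr
  have hc : csq γ S0 ρ r ≠ 0 :=
    (mul_pos (mul_pos (zero_lt_one.trans hγ) (Real.exp_pos S0)) (Real.rpow_pos_of_pos hpos _)).ne'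
  have hd : HasDerivWithinAt ρ _ (Icc r0 r1) r :=
    ((hρ.differentiableOn one_ne_zero) r hr).hasDerivWithinAt
  rw [hode r hr] at hd
  have hsub : csq γ S0 ρ r - Ubar1 J1 ρ r ^ 2 ≠ 0 := sub_ne_zero.mpr (hnonsonic r hr)
  refine ((hasDerivWithinAt_M2sq hd hpos hrpos hc).derivWithin
    (uniqueDiffOn_Icc hr01 r hr)).trans ?_
  have hM : 1 - M1sq γ S0 J1 ρ r = (csq γ S0 ρ r - Ubar1 J1 ρ r ^ 2) / csq γ S0 ρ r := by
    rw [M1sq, sub_div, div_self hc]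
  have hρr := hpos.ne'
  rw [hM]
  simp only [M1sq, M2sq]
  generalize csq γ S0 ρ r = c at *
  generalize Ubar1 J1 ρ r = u at *
  generalize Ubar2 J2 r = v at *
  field_simp
  ring
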